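/- For every natural number n, the number of permutations of {1,…,n} avoiding the pattern 123 equals the n-th Catalan number C_n = (1/(n+1))·binom(2n, n). -/

import Mathlib

/-- A permutation `σ` of `{1,…,n}` contains the pattern `τ` (given in one-line
notation as a function `Fin k → ℕ`) if there is a strictly increasing choice of
indices along which `σ` is order-isomorphic to `τ`. -/
def Contains {n k : ℕ} (σ : Equiv.Perm (Fin n)) (τ : Fin k → ℕ) : Prop :=
  ∃ f : Fin k → Fin n, StrictMono f ∧ ∀ a b : Fin k, σ (f a) < σ (f b) ↔ τ a < τ b

/-- `σ` avoids the pattern `τ`. -/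
def Avoids {n k : ℕ} (σ : Equiv.Perm (Fin n)) (τ : Fin k → ℕ) : Prop :=
  ¬ Contains σ τ

def p123 : Fin 3 → ℕ := ![1, 2, 3]
def p132 : Fin 3 → ℕ := ![1, 3, 2]
def p213 : Fin 3 → ℕ := ![2, 1, 3]
def p1432 : Fin 4 → ℕ := ![1, 4, 3, 2]
def p3214 : Fin 4 → ℕ := ![3, 2, 1, 4]
def p2143 : Fin 4 → ℕ := ![2, 1, 4, 3]

/-- The pattern `q_k = 1 (k+1) k (k-1) ⋯ 2` of length `k+1` (one-line notation,
position `j` is 0-indexed here, values 1-indexed). -/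
def qpat (k : ℕ) : Fin (k + 1) → ℕ := fun j => if j.val = 0 then 1 else k + 2 - j.val

/-- The pattern `r_k = k (k-1) ⋯ 2 1 (k+1)` of length `k+1`. -/
def rpat (k : ℕ) : Fin (k + 1) → ℕ := fun j => if j.val = k then k + 1 else k - j.val

/-- The pattern `s_k = (k-1)(k-2) ⋯ 2 1 (k+1) k` of length `k+1`. -/
def spat (k : ℕ) : Fin (k + 1) → ℕ := fun j =>
  if j.val = k - 1 then k + 1 else if j.val = k then k else k - 1 - j.val

/-- The pattern `u_k = 2 1 (k+1) k (k-1) ⋯ 4 3` of length `k+1`. -/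
def upat (k : ℕ) : Fin (k + 1) → ℕ := fun j =>
  if j.val = 0 then 2 else if j.val = 1 then 1 else k + 3 - j.val

/-- Prepend the value `v` to the permutation `σ`. -/
def ins {n : ℕ} (v : Fin (n + 1)) (σ : Equiv.Perm (Fin n)) : Equiv.Perm (Fin (n + 1)) :=
  ((finSuccEquiv' 0).trans (Equiv.optionCongr σ)).trans (finSuccEquiv' v).symm

lemma ins_zero {n : ℕ} (v : Fin (n + 1)) (σ : Equiv.Perm (Fin n)) : ins v σ 0 = v := by
  simp [ins]

lemma ins_succ {n : ℕ} (v : Fin (n + 1)) (σ : Equiv.Perm (Fin n)) (i : Fin n) :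
    ins v σ i.succ = v.succAbove (σ i) := by
  have : finSuccEquiv' (0 : Fin (n + 1)) i.succ = some i := by
    have := finSuccEquiv'_succAbove (0 : Fin (n + 1)) i
    simpa using this
  simp [ins, this]

lemma ins_bij (n : ℕ) :
    Function.Bijective (fun p : Fin (n + 1) × Equiv.Perm (Fin n) => ins p.1 p.2) := by
  rw [Fintype.bijective_iff_injective_and_card]
  constructor
  · rintro ⟨v, σ⟩ ⟨w, τ⟩ h
    simp only at h
    have h0 : v = w := by rw [← ins_zero v σ, h, ins_zero]
    subst h0
    have : σ = τ := by
      ext i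
      have := congrArg (fun f => f i.succ) h
      simp only [ins_succ] at this
      rw [Fin.succAbove_right_injective this]
    rw [this]
  · simp [Fintype.card_perm, Nat.factorial_succ]

/-- Avoids 123 and all bottoms of ascents are below `j`. -/
def Good (n j : ℕ) (σ : Equiv.Perm (Fin n)) : Prop :=
  (∀ i k l : Fin n, i < k → k < l → σ i < σ k → ¬ σ k < σ l) ∧
    ∀ i k : Fin n, i < k → σ i < σ k → (σ i : ℕ) < j

lemma sa_val {n : ℕ} (v : Fin (n + 1)) (x : Fin n) :
    ((v.succAbove x : Fin (n + 1)) : ℕ) = if (x : ℕ) < v then (x : ℕ) else x + 1 := by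
  unfold Fin.succAbove
  by_cases h : (x : ℕ) < v
  · simp [Fin.lt_def, h]
  · simp [Fin.lt_def, h]

lemma good_ins {n j : ℕ} (v : Fin (n + 1)) (σ : Equiv.Perm (Fin n)) :
    Good (n + 1) j (ins v σ) ↔ Good n v σ ∧ ((v : ℕ) < j ∨ ((v : ℕ) = n ∧ Good n j σ)) := by
  constructor
  · rintro ⟨h1, h2⟩
    have g1 : ∀ i k l : Fin n, i < k → k < l → σ i < σ k → ¬ σ k < σ l := by
      intro i k l hik hkl a b
      refine h1 i.succ k.succ l.succ (by simpa) (by simpa) ?_ ?_ <;>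
        rw [ins_succ, ins_succ] <;> simpa
    have g2 : ∀ i k : Fin n, i < k → σ i < σ k → (σ i : ℕ) < v := by
      intro i k hik a
      by_contra hc
      refine h1 0 i.succ k.succ (by simp) (by simpa) ?_ ?_
      · rw [ins_zero, ins_succ, Fin.lt_def, sa_val]
        split_ifs; omega
      · rw [ins_succ, ins_succ]; simpa
    refine ⟨⟨g1, g2⟩, ?_⟩
    by_cases hv : (v : ℕ) < n
    · left
      have := h2 0 (σ.symm ⟨v, hv⟩).succ (by simp)
      rw [ins_zero, ins_succ, Fin.lt_def, sa_val] at this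
      simpa using this
    · right
      refine ⟨by omega, g1, ?_⟩
      intro i k hik a
      have := h2 i.succ k.succ (by simpa)
      rw [ins_succ, ins_succ] at this
      have := this (by simpa)
      rw [sa_val, if_pos (g2 i k hik a)] at this
      exact this
  · rintro ⟨⟨g1, g2⟩, h⟩
    constructor
    · intro i k l hik hkl
      obtain ⟨k, rfl⟩ := Fin.exists_succ_eq.2 (Fin.ne_zero_of_lt hik)
      obtain ⟨l, rfl⟩ := Fin.exists_succ_eq.2 (Fin.ne_zero_of_lt hkl)
      rw [ins_succ, ins_succ]
      intro a b
      rw [Fin.succAbove_lt_succAbove_iff] at b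
      rw [Fin.succ_lt_succ_iff] at hkl
      rcases Fin.eq_zero_or_eq_succ i with rfl | ⟨i, rfl⟩
      · rw [ins_zero, Fin.lt_def, sa_val, if_pos (g2 k l hkl b)] at a
        have := g2 k l hkl b
        omega
      · rw [ins_succ, Fin.succAbove_lt_succAbove_iff] at a
        exact g1 i k l (by simpa using hik) hkl a b
    · intro i k hik
      obtain ⟨k, rfl⟩ := Fin.exists_succ_eq.2 (Fin.ne_zero_of_lt hik)
      rw [ins_succ]
      intro a
      rcases Fin.eq_zero_or_eq_succ i with rfl | ⟨i, rfl⟩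
      · rw [ins_zero] at a ⊢
        rw [Fin.lt_def] at a
        have := (v.succAbove (σ k)).isLt
        rcases h with h | h <;> omega
      · rw [ins_succ] at a ⊢
        rw [Fin.succAbove_lt_succAbove_iff] at a
        rw [Fin.succ_lt_succ_iff] at hik
        have := g2 i k hik a
        rw [sa_val, if_pos this]
        rcases h with h | ⟨_, h⟩
        · omega
        · exact h.2 i k hik a

/-- Number of good permutations. -/
noncomputable def cnt (n j : ℕ) : ℕ := Nat.card {σ : Equiv.Perm (Fin n) // Good n j σ}

lemma cnt_succ (n j : ℕ) (hj : j ≤ n) :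
    cnt (n + 1) j = ∑ v ∈ Finset.range (j + 1), cnt n v := by
  classical
  have e : {σ : Equiv.Perm (Fin (n + 1)) // Good (n + 1) j σ} ≃
      (v : Fin (n + 1)) × {σ : Equiv.Perm (Fin n) // Good (n + 1) j (ins v σ)} :=
    ((Equiv.ofBijective _ (ins_bij n)).subtypeEquiv (fun _ => Iff.rfl)).symm.trans
      (Equiv.subtypeProdEquivSigmaSubtype
        (fun (v : Fin (n + 1)) (σ : Equiv.Perm (Fin n)) => Good (n + 1) j (ins v σ)))
  have h1 : cnt (n + 1) j = ∑ v : Fin (n + 1),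
      (if (v : ℕ) < j then cnt n v else if (v : ℕ) = n then cnt n j else 0) := by
    unfold cnt
    rw [Nat.card_congr e, Nat.card_sigma]
    refine Finset.sum_congr rfl fun v _ => ?_
    split_ifs with a b
    · refine Nat.card_congr (Equiv.subtypeEquivRight fun σ => ?_)
      rw [good_ins]; tauto
    · refine Nat.card_congr (Equiv.subtypeEquivRight fun σ => ?_)
      rw [good_ins]
      constructor
      · rintro ⟨_, h | h⟩
        · exact absurd h a
        · exact h.2
      · intro h
        exact ⟨⟨h.1, fun i k _ _ => by have := (σ i).isLt; omega⟩, Or.inr ⟨b, h⟩⟩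
    · have : IsEmpty {σ : Equiv.Perm (Fin n) // Good (n + 1) j (ins v σ)} := by
        refine ⟨fun ⟨σ, h⟩ => ?_⟩
        rw [good_ins] at h
        tauto
      exact Nat.card_of_isEmpty
  rw [h1, Fin.sum_univ_eq_sum_range
    (fun v => if v < j then cnt n v else if v = n then cnt n j else 0) (n + 1),
    Finset.sum_range_succ, Finset.sum_range_succ]
  congr 1
  · rw [← Finset.sum_subset (Finset.range_mono hj)]
    · exact Finset.sum_congr rfl fun v hv => by simp [Finset.mem_range.1 hv]
    · intro v hv hv'
      simp only [Finset.mem_range] at hv hv'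
      rw [if_neg hv', if_neg (by omega)]
  · rw [if_neg (by omega), if_pos rfl]

lemma cnt_top (n : ℕ) : cnt (n + 1) (n + 1) = cnt (n + 1) n := by
  unfold cnt
  refine Nat.card_congr (Equiv.subtypeEquivRight fun σ => ?_)
  unfold Good
  refine and_congr_right fun _ => ?_
  refine forall₄_congr fun i k _ h => ?_
  have := (σ k).isLt
  rw [Fin.lt_def] at h
  constructor <;> intro <;> omega

lemma cnt_zero_zero : cnt 0 0 = 1 := by
  unfold cnt
  rw [Nat.card_eq_one_iff_unique]
  exact ⟨⟨fun a b => Subtype.ext (Subsingleton.elim _ _)⟩,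
    ⟨⟨1, fun i => i.elim0, fun i => i.elim0⟩⟩⟩

lemma cnt_zero (n : ℕ) : cnt n 0 = 1 := by
  induction n with
  | zero => exact cnt_zero_zero
  | succ n ih => rw [cnt_succ n 0 (by omega)]; simpa

lemma cnt_formula (n : ℕ) : ∀ j, j + 1 ≤ n →
    cnt n (j + 1) + (n + j + 1).choose j = (n + j + 1).choose (j + 1) := by
  induction n with
  | zero => intro j hj; omega
  | succ n ih =>
    intro j
    induction j with
    | zero =>
      intro _
      rcases Nat.eq_zero_or_pos n with rfl | hn
      · rw [cnt_top, cnt_zero]; rfl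
      · have := ih 0 hn
        rw [cnt_succ n (0 + 1) (by omega), Finset.sum_range_succ, Finset.sum_range_one, cnt_zero]
        simp at this ⊢
        omega
    | succ j ihj =>
      intro hj
      have h1 := ihj (by omega)
      have p1 := Nat.choose_succ_succ' (n + j + 2) j
      have p2 := Nat.choose_succ_succ' (n + j + 2) (j + 1)
      rw [show n + 1 + j + 1 = n + j + 2 by omega] at h1
      rw [show n + 1 + (j + 1) + 1 = n + j + 2 + 1 by omega]
      rcases Nat.lt_or_ge n (j + 2) with h | h
      · obtain rfl : n = j + 1 := by omega
        rw [cnt_top]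
        have s : (j + 1 + j + 2).choose (j + 1) = (j + 1 + j + 2).choose (j + 1 + 1) :=
          Nat.choose_symm_of_eq_add (by omega)
        omega
      · have h2 := ih (j + 1) (by omega)
        rw [cnt_succ n (j + 1) (by omega)] at h1
        rw [cnt_succ n (j + 1 + 1) (by omega), Finset.sum_range_succ _ (j + 1 + 1)]
        rw [show n + (j + 1) + 1 = n + j + 2 by omega] at h2
        omega

lemma avoids_iff {n : ℕ} (σ : Equiv.Perm (Fin n)) : Avoids σ p123 ↔ Good n n σ := by
  unfold Avoids Contains Good
  constructor
  · intro h
    refine ⟨fun i k l hik hkl a b => h ⟨![i, k, l], ?_, ?_⟩, fun i _ _ _ => (σ i).isLt⟩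
    · rw [Fin.strictMono_iff_lt_succ]
      intro x
      fin_cases x
      · exact hik
      · exact hkl
    · have c := a.trans b
      intro x y
      fin_cases x <;> fin_cases y <;> simp [p123, a, b, c, a.le, b.le, c.le]
  · rintro ⟨h, _⟩ ⟨f, hf, hp⟩
    exact h (f 0) (f 1) (f 2) (hf (by decide)) (hf (by decide))
      ((hp 0 1).2 (by decide)) ((hp 1 2).2 (by decide))

theorem stmt0 (n : ℕ) :
    Nat.card {σ : Equiv.Perm (Fin n) // Avoids σ p123} = (2 * n).choose n / (n + 1) := by
  rw [Nat.card_congr (Equiv.subtypeEquivRight fun σ => avoids_iff σ)]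
  change cnt n n = _
  rcases n with _ | m
  · rw [cnt_zero_zero]; rfl
  · have h := cnt_formula (m + 1) m le_rfl
    rw [show m + 1 + m + 1 = 2 * (m + 1) by omega] at h
    have h2 := Nat.choose_succ_right_eq (2 * (m + 1)) m
    rw [show 2 * (m + 1) - m = m + 2 by omega] at h2
    symm
    apply Nat.div_eq_of_eq_mul_left (by omega)
    rw [show m + 1 + 1 = m + 2 by omega]
    nlinarith
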